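/- Let φ = c·B be a unimodular constant c times a finite Blaschke product B with n zeros (counted with multiplicity), and suppose φ(0) ∈ ℝ. Then there exist distinct points λ_1,…,λ_n ∈ 𝕋 and weights m_1,…,m_n > 0 such that (1+φ(z))/(1−φ(z)) = −∑_{k=1}^n m_k (z + λ_k)/(z − λ_k) for all z ∈ 𝔻; moreover m_k = 1/(λ_k φ'(λ_k)) for each k. The measure μ = ∑ m_k δ_{λ_k} is a probability measure if and only if φ(0) = 0. -/

import Mathlib

open Finset ComplexConjugate

theorem aux_key (a w : ℂ) : Complex.normSq (1 - conj a * w) - Complex.normSq (w - a)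
    = (1 - Complex.normSq a) * (1 - Complex.normSq w) := by
  simp [Complex.normSq_apply]; ring

theorem aux_key' (a w : ℂ) : ‖1 - conj a * w‖ ^ 2 - ‖w - a‖ ^ 2
    = (1 - ‖a‖ ^ 2) * (1 - ‖w‖ ^ 2) := by
  simpa [Complex.normSq_eq_norm_sq] using aux_key a w

theorem aux_den (a w : ℂ) (ha : ‖a‖ < 1) (hw : ‖w‖ ≤ 1) : 1 - conj a * w ≠ 0 := by
  intro h
  have h1 : conj a * w = 1 := (sub_eq_zero.mp h).symm
  have h2 : ‖a‖ * ‖w‖ = 1 := by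
    have := congrArg norm h1
    simpa using this
  nlinarith [norm_nonneg a, norm_nonneg w]

theorem aux_lt (a w : ℂ) (ha : ‖a‖ < 1) (hw : ‖w‖ < 1) : ‖w - a‖ < ‖1 - conj a * w‖ := by
  have h := aux_key' a w
  have h1 : 0 < (1 - ‖a‖ ^ 2) * (1 - ‖w‖ ^ 2) := by
    apply mul_pos <;> nlinarith [norm_nonneg a, norm_nonneg w]
  exact lt_of_pow_lt_pow_left₀ 2 (norm_nonneg _) (by linarith)

theorem aux_gt (a w : ℂ) (ha : ‖a‖ < 1) (hw : 1 < ‖w‖) : ‖1 - conj a * w‖ < ‖w - a‖ := by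
  have h := aux_key' a w
  have h1 : 0 < (1 - ‖a‖ ^ 2) * (‖w‖ ^ 2 - 1) := by
    apply mul_pos <;> nlinarith [norm_nonneg a, norm_nonneg w]
  exact lt_of_pow_lt_pow_left₀ 2 (norm_nonneg _) (by linarith)

theorem aux_root {n : ℕ} (hn : 0 < n) (c : ℂ) (hc : ‖c‖ = 1) (α : Fin n → ℂ)
    (hα : ∀ j, ‖α j‖ < 1) (w : ℂ)
    (h : ∏ j, (1 - conj (α j) * w) = c * ∏ j, (w - α j)) : ‖w‖ = 1 := by
  have hne : (Finset.univ : Finset (Fin n)).Nonempty := ⟨⟨0, hn⟩, mem_univ _⟩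
  have hnorm : ∏ j, ‖1 - conj (α j) * w‖ = ∏ j, ‖w - α j‖ := by
    have := congrArg norm h
    simpa only [norm_mul, hc, one_mul, norm_prod] using this
  rcases lt_trichotomy ‖w‖ 1 with hw | hw | hw
  · exfalso
    have h1 : ∏ j, ‖1 - conj (α j) * w‖ ≠ 0 :=
      prod_ne_zero_iff.mpr fun j _ => norm_ne_zero_iff.mpr (aux_den _ _ (hα j) hw.le)
    rw [hnorm] at h1
    have h2 : ∀ j ∈ (univ : Finset (Fin n)), 0 < ‖w - α j‖ := fun j hj =>
      lt_of_le_of_ne (norm_nonneg _) (prod_ne_zero_iff.mp h1 j hj).symm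
    exact (prod_lt_prod_of_nonempty h2 (fun j _ => aux_lt _ _ (hα j) hw) hne).ne hnorm.symm
  · exact hw
  · exfalso
    have h1 : ∏ j, ‖w - α j‖ ≠ 0 :=
      prod_ne_zero_iff.mpr fun j _ => 
        (lt_of_le_of_lt (norm_nonneg _) (aux_gt _ _ (hα j) hw)).ne'
    rw [← hnorm] at h1
    have h2 : ∀ j ∈ (univ : Finset (Fin n)), 0 < ‖1 - conj (α j) * w‖ := fun j hj =>
      lt_of_le_of_ne (norm_nonneg _) (prod_ne_zero_iff.mp h1 j hj).symm
    exact (prod_lt_prod_of_nonempty h2 (fun j _ => aux_gt _ _ (hα j) hw) hne).ne hnorm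

open Polynomial in
/-- Numerator polynomial. -/
noncomputable def auxP {n : ℕ} (c : ℂ) (α : Fin n → ℂ) : ℂ[X] := C c * ∏ j, (X - C (α j))

open Polynomial in
/-- Denominator polynomial. -/
noncomputable def auxQ {n : ℕ} (α : Fin n → ℂ) : ℂ[X] := ∏ j, (1 - C (conj (α j)) * X)

theorem auxP_eval {n : ℕ} (c : ℂ) (α : Fin n → ℂ) (z : ℂ) :
    (auxP c α).eval z = c * ∏ j, (z - α j) := by
  simp [auxP, Polynomial.eval_prod]

theorem auxQ_eval {n : ℕ} (α : Fin n → ℂ) (z : ℂ) :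
    (auxQ α).eval z = ∏ j, (1 - conj (α j) * z) := by
  simp [auxQ, Polynomial.eval_prod]

open Polynomial in
theorem auxP_deg {n : ℕ} (c : ℂ) (α : Fin n → ℂ) : (auxP c α).natDegree ≤ n := by
  refine (natDegree_C_mul_le _ _).trans ?_
  rw [natDegree_prod_of_monic _ _ (fun i _ => monic_X_sub_C _)]
  simp

open Polynomial in
theorem auxQ_deg {n : ℕ} (α : Fin n → ℂ) : (auxQ α).natDegree ≤ n := by
  refine (natDegree_prod_le _ _).trans ?_
  refine (sum_le_sum (g := fun _ => 1) fun i _ => ?_).trans (by simp)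
  compute_degree

open Polynomial in
theorem auxP_coeff {n : ℕ} (c : ℂ) (α : Fin n → ℂ) : (auxP c α).coeff n = c := by
  have := coeff_prod_of_natDegree_le (univ : Finset (Fin n)) (fun j => X - C (α j)) 1
    (fun j _ => by simp)
  simp at this
  rw [auxP, coeff_C_mul, this, mul_one]

open Polynomial in
theorem auxQ_coeff {n : ℕ} (α : Fin n → ℂ) : (auxQ α).coeff n = ∏ j, (- conj (α j)) := by
  have := coeff_prod_of_natDegree_le (univ : Finset (Fin n)) (fun j => 1 - C (conj (α j)) * X) 1
    (fun j _ => by compute_degree)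
  simp [coeff_one] at this
  rw [auxQ, this]

theorem auxD_coeff {n : ℕ} (hn : 0 < n) (c : ℂ) (hc : ‖c‖ = 1) (α : Fin n → ℂ)
    (hα : ∀ j, ‖α j‖ < 1) : (auxQ α - auxP c α).coeff n ≠ 0 := by
  rw [Polynomial.coeff_sub, auxP_coeff, auxQ_coeff]
  intro h
  have h1 := congrArg norm (sub_eq_zero.mp h)
  rw [hc, norm_prod] at h1
  have h2 : ∏ j, ‖-conj (α j)‖ ≤ ‖α ⟨0, hn⟩‖ := by
    rw [← Finset.mul_prod_erase _ _ (mem_univ (⟨0, hn⟩ : Fin n))]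
    simp only [norm_neg, RCLike.norm_conj]
    exact mul_le_of_le_one_right (norm_nonneg _)
      (prod_le_one (fun _ _ => norm_nonneg _) fun j _ => (hα j).le)
  linarith [hα ⟨0, hn⟩]

theorem auxD_deg {n : ℕ} (hn : 0 < n) (c : ℂ) (hc : ‖c‖ = 1) (α : Fin n → ℂ)
    (hα : ∀ j, ‖α j‖ < 1) : (auxQ α - auxP c α).natDegree = n :=
  Polynomial.natDegree_eq_of_le_of_coeff_ne_zero
    ((Polynomial.natDegree_sub_le _ _).trans (max_le (auxQ_deg α) (auxP_deg c α)))
    (auxD_coeff hn c hc α hα)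

theorem auxD_root {n : ℕ} (hn : 0 < n) (c : ℂ) (hc : ‖c‖ = 1) (α : Fin n → ℂ)
    (hα : ∀ j, ‖α j‖ < 1) (w : ℂ) (hw : (auxQ α - auxP c α).eval w = 0) : ‖w‖ = 1 := by
  rw [Polynomial.eval_sub, auxP_eval, auxQ_eval, sub_eq_zero] at hw
  exact aux_root hn c hc α hα w hw

theorem auxQ_ne {n : ℕ} (α : Fin n → ℂ)
    (hα : ∀ j, ‖α j‖ < 1) (w : ℂ) (hw : ‖w‖ ≤ 1) : (auxQ α).eval w ≠ 0 := by
  rw [auxQ_eval]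
  exact prod_ne_zero_iff.mpr fun j _ => aux_den _ _ (hα j) hw

theorem aux_factor (a w : ℂ) (ha : ‖a‖ < 1) (hw : ‖w‖ = 1) :
    w * logDeriv (fun z => (z - a) / (1 - conj a * z)) w
      = (((1 - ‖a‖ ^ 2) / ‖w - a‖ ^ 2 : ℝ) : ℂ) := by
  have h1 := aux_den a w ha hw.le
  have h2 : w - a ≠ 0 := by
    intro h; rw [sub_eq_zero.mp h] at hw; linarith
  have hww : w * conj w = 1 := by
    rw [Complex.mul_conj, Complex.normSq_eq_norm_sq, hw]; simp
  have e1 : 1 - conj a * w = w * conj (w - a) := by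
    rw [map_sub, mul_sub, hww]; ring
  have haa : ((‖a‖ ^ 2 : ℝ) : ℂ) = a * conj a := by
    rw [Complex.mul_conj, Complex.normSq_eq_norm_sq]
  have hwa : ((‖w - a‖ ^ 2 : ℝ) : ℂ) = (w - a) * conj (w - a) := by
    rw [Complex.mul_conj, Complex.normSq_eq_norm_sq]
  have hD : logDeriv (fun z => (z - a) / (1 - conj a * z)) w
      = 1 / (w - a) - (-conj a) / (1 - conj a * w) := by
    rw [logDeriv_div w h2 h1 (by fun_prop) (by fun_prop)]
    simp [logDeriv_apply]
  have h3 : conj (w - a) ≠ 0 := (map_ne_zero _).mpr h2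
  have h4 : w ≠ 0 := by rintro rfl; simp at hw
  rw [hD, Complex.ofReal_div, Complex.ofReal_sub, Complex.ofReal_one, haa, hwa, e1]
  field_simp
  rw [map_sub]
  linear_combination hww

theorem aux_deriv {n : ℕ} (hn : 0 < n) (c : ℂ) (hc : ‖c‖ = 1) (α : Fin n → ℂ)
    (hα : ∀ j, ‖α j‖ < 1)
    (φ : ℂ → ℂ) (hφ : ∀ z, φ z = c * ∏ j, (z - α j) / (1 - conj (α j) * z))
    (w : ℂ) (hw : ‖w‖ = 1) (h1 : φ w = 1) :
    ∃ s : ℝ, 0 < s ∧ w * deriv φ w = s := by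
  have hwa : ∀ j, w - α j ≠ 0 := by
    intro j h; have := hα j; rw [← sub_eq_zero.mp h] at this; linarith
  have hc0 : c ≠ 0 := by rintro rfl; simp at hc
  refine ⟨∑ j, (1 - ‖α j‖ ^ 2) / ‖w - α j‖ ^ 2, ?_, ?_⟩
  · apply sum_pos _ ⟨⟨0, hn⟩, mem_univ _⟩
    intro j _
    apply div_pos
    · nlinarith [hα j, norm_nonneg (α j)]
    · have := norm_pos_iff.mpr (hwa j); positivity
  · have e : deriv φ w = logDeriv φ w := by rw [logDeriv_apply, h1, div_one]
    have hf : φ = fun z => c * ∏ j, (z - α j) / (1 - conj (α j) * z) := funext hφ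
    rw [e, hf, logDeriv_const_mul _ _ hc0,
      logDeriv_prod (f := fun j z => (z - α j) / (1 - conj (α j) * z))
        (fun j _ => div_ne_zero (hwa j) (aux_den _ _ (hα j) hw.le))
        (fun j _ => DifferentiableAt.div (by fun_prop) (by fun_prop) (aux_den _ _ (hα j) hw.le)),
      mul_sum, Complex.ofReal_sum]
    exact sum_congr rfl fun j _ => aux_factor _ _ (hα j) hw

theorem aux_phi {n : ℕ} (c : ℂ) (α : Fin n → ℂ)
    (φ : ℂ → ℂ) (hφ : ∀ z, φ z = c * ∏ j, (z - α j) / (1 - conj (α j) * z)) (z : ℂ) :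
    φ z = (auxP c α).eval z / (auxQ α).eval z := by
  rw [hφ, auxP_eval, auxQ_eval, prod_div_distrib, mul_div_assoc]

open Polynomial in
theorem aux_Dderiv {n : ℕ} (c : ℂ) (α : Fin n → ℂ)
    (hα : ∀ j, ‖α j‖ < 1)
    (φ : ℂ → ℂ) (hφ : ∀ z, φ z = c * ∏ j, (z - α j) / (1 - conj (α j) * z))
    (w : ℂ) (hw : ‖w‖ = 1) (h1 : (auxQ α - auxP c α).eval w = 0) :
    (derivative (auxQ α - auxP c α)).eval w = - (auxQ α).eval w * deriv φ w := by
  have hq := auxQ_ne α hα w hw.le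
  have hf : φ = fun z => (auxP c α).eval z / (auxQ α).eval z := funext (aux_phi c α φ hφ)
  have hd := ((auxP c α).hasDerivAt w).div ((auxQ α).hasDerivAt w) hq
  have hf' : φ = (fun z => (auxP c α).eval z) / (fun z => (auxQ α).eval z) := hf
  rw [hf', hd.deriv]
  rw [eval_sub, sub_eq_zero] at h1
  rw [← h1, derivative_sub, eval_sub]
  field_simp
  ring

theorem aux_imag (w l : ℂ) (hw : ‖w‖ = 1) (hl : ‖l‖ = 1) : ((w + l) / (w - l)).re = 0 := by
  have h1 : w.re * w.re + w.im * w.im = 1 := by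
    rw [← Complex.normSq_apply, Complex.normSq_eq_norm_sq, hw]; norm_num
  have h2 : l.re * l.re + l.im * l.im = 1 := by
    rw [← Complex.normSq_apply, Complex.normSq_eq_norm_sq, hl]; norm_num
  rw [Complex.div_re, ← add_div]
  have : (w + l).re * (w - l).re + (w + l).im * (w - l).im = 0 := by
    simp; linear_combination h1 - h2
  rw [this, zero_div]

open Polynomial in
theorem aux_pf {n : ℕ} (N D : ℂ[X]) (hN : N.natDegree ≤ n) (d : ℂ) (hd : d ≠ 0)
    (lam : Fin n → ℂ) (hinj : Function.Injective lam)
    (hD : D = C d * ∏ k, (X - C (lam k))) (m : Fin n → ℂ)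
    (hm : ∀ k, N.eval (lam k) = - (2 * m k * lam k * (derivative D).eval (lam k))) :
    ∃ κ : ℂ, ∀ z, D.eval z ≠ 0 →
      N.eval z / D.eval z + ∑ k, m k * (z + lam k) / (z - lam k) = κ := by
  classical
  set S : ℂ[X] := ∑ k, C (m k * d) * (X + C (lam k)) * ∏ i ∈ univ.erase k, (X - C (lam i)) with hS
  have hSdeg : S.natDegree ≤ n := by
    apply natDegree_sum_le_of_forall_le
    intro k _
    refine natDegree_mul_le.trans ?_
    rw [natDegree_prod_of_monic _ _ (fun i _ => monic_X_sub_C _)]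
    have h1 : (C (m k * d) * (X + C (lam k))).natDegree ≤ 1 := by compute_degree
    have hk := k.2
    simp only [natDegree_X_sub_C, sum_const, smul_eq_mul, mul_one, mem_univ, card_erase_of_mem,
      card_univ, Fintype.card_fin]
    omega
  have hDdeg : D.natDegree ≤ n := by
    rw [hD]
    refine (natDegree_C_mul_le _ _).trans ?_
    rw [natDegree_prod_of_monic _ _ (fun i _ => monic_X_sub_C _)]
    simp
  have hDc : D.coeff n = d := by
    have := auxP_coeff d lam
    rwa [auxP, ← hD] at this
  refine ⟨(N + S).coeff n / d, ?_⟩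
  have hEq : N + S = C ((N + S).coeff n / d) * D := by
    apply eq_of_degree_sub_lt_of_eval_index_eq (s := univ) (v := lam) hinj.injOn
    · rw [card_univ, Fintype.card_fin, degree_lt_iff_coeff_zero]
      intro i hi
      rcases hi.eq_or_lt with rfl | hi
      · rw [coeff_sub, coeff_C_mul, hDc, div_mul_cancel₀ _ hd, sub_self]
      · apply coeff_eq_zero_of_natDegree_lt
        refine lt_of_le_of_lt ((natDegree_sub_le _ _).trans (max_le ?_ ?_)) hi
        · exact (natDegree_add_le _ _).trans (max_le hN hSdeg)
        · exact (natDegree_C_mul_le _ _).trans hDdeg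
    · intro k _
      have e1 : D.eval (lam k) = 0 := by
        rw [hD, eval_mul, eval_prod, prod_eq_zero (mem_univ k) (by simp), mul_zero]
      have e2 : (derivative D).eval (lam k) = d * ∏ i ∈ univ.erase k, (lam k - lam i) := by
        rw [hD, derivative_C_mul, derivative_prod_finset, eval_mul, eval_C, eval_finsetSum,
          sum_eq_single k]
        · simp [eval_prod]
        · intro b _ hb
          rw [eval_mul, eval_prod, prod_eq_zero (mem_erase.mpr ⟨hb.symm, mem_univ k⟩) (by simp),
            zero_mul]
        · simp
      have e3 : S.eval (lam k) = m k * d * (lam k + lam k) * ∏ i ∈ univ.erase k, (lam k - lam i) := by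
        rw [hS, eval_finsetSum, sum_eq_single k]
        · simp [eval_prod]
        · intro b _ hb
          rw [eval_mul, eval_prod, prod_eq_zero (mem_erase.mpr ⟨hb.symm, mem_univ k⟩) (by simp),
            mul_zero]
        · simp
      rw [eval_add, eval_mul, e1, e3, hm, e2]
      ring
  intro z hz
  have hz' := hz
  rw [hD, eval_mul, eval_prod, eval_C] at hz'
  have hne : ∀ k, z - lam k ≠ 0 := by
    intro k
    have := prod_ne_zero_iff.mp (right_ne_zero_of_mul hz') k (mem_univ k)
    simpa using this
  have hSz : ∑ k, m k * (z + lam k) / (z - lam k) = S.eval z / D.eval z := by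
    rw [hS, eval_finsetSum, sum_div]
    apply sum_congr rfl
    intro k _
    rw [div_eq_div_iff (hne k) hz, hD, eval_mul, eval_prod, ← mul_prod_erase _ _ (mem_univ k)]
    simp [eval_prod]
    ring
  rw [hSz, ← add_div, ← eval_add]
  conv_lhs => rw [hEq]
  rw [eval_mul, eval_C, mul_div_cancel_right₀ _ hz]

theorem stmt7 (n : ℕ) (c : ℂ) (hc : ‖c‖ = 1) (α : Fin n → ℂ) (hα : ∀ j, ‖α j‖ < 1)
    (φ : ℂ → ℂ) (hφ : ∀ z, φ z = c * ∏ j, (z - α j) / (1 - conj (α j) * z))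
    (hreal : (φ 0).im = 0) :
    ∃ (lam : Fin n → ℂ) (m : Fin n → ℝ),
      Function.Injective lam ∧ (∀ k, ‖lam k‖ = 1) ∧ (∀ k, 0 < m k) ∧
      (∀ z : ℂ, ‖z‖ < 1 →
        (1 + φ z) / (1 - φ z) = -∑ k, (m k : ℂ) * (z + lam k) / (z - lam k)) ∧
      (∀ k, (m k : ℂ) = 1 / (lam k * deriv φ (lam k))) ∧
      ((∑ k, m k = 1) ↔ φ 0 = 0) := by
  rcases Nat.eq_zero_or_pos n with rfl | hn
  · have hφc : ∀ z, φ z = c := fun z => by rw [hφ]; simp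
    have hc0 : c ≠ 0 := by rintro rfl; simp at hc
    refine ⟨fun _ => 0, fun _ => 0, fun a => a.elim0, fun a => a.elim0, fun a => a.elim0, ?_,
      fun a => a.elim0, ?_⟩
    · intro z _
      rw [hφc] at hreal ⊢
      have h1 : c.re * c.re + c.im * c.im = 1 := by
        rw [← Complex.normSq_apply, Complex.normSq_eq_norm_sq, hc]; norm_num
      rw [hreal] at h1
      have h2 : (c.re - 1) * (c.re + 1) = 0 := by linarith
      rcases mul_eq_zero.mp h2 with h | h
      · have : c = 1 := Complex.ext (by simp; linarith) (by simpa using hreal)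
        simp [this]
      · have : c = -1 := Complex.ext (by simp; linarith) (by simpa using hreal)
        simp [this]
    · simp [hφc, hc0]
  set D := auxQ α - auxP c α with hDdef
  have hDn : D.natDegree = n := auxD_deg hn c hc α hα
  have hD0 : D ≠ 0 := by
    intro h; rw [h] at hDn; simp at hDn; omega
  have hroot : ∀ w, D.eval w = 0 → ‖w‖ = 1 := auxD_root hn c hc α hα
  have hphi1 : ∀ w, D.eval w = 0 → φ w = 1 := by
    intro w hw
    have hq := auxQ_ne α hα w (hroot w hw).le
    rw [aux_phi c α φ hφ]
    rw [hDdef, Polynomial.eval_sub, sub_eq_zero] at hw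
    rw [← hw, div_self hq]
  have hcard : D.roots.card = n := by
    rw [← hDn]; exact Polynomial.splits_iff_card_roots.mp (IsAlgClosed.splits D)
  have hnd : D.roots.Nodup := by
    rw [Multiset.nodup_iff_count_le_one]
    intro w
    rw [Polynomial.count_roots]
    by_contra! h
    obtain ⟨h1, h2⟩ := (Polynomial.one_lt_rootMultiplicity_iff_isRoot hD0).mp h
    have hw := hroot w h1
    obtain ⟨s, hs, hs'⟩ := aux_deriv hn c hc α hα φ hφ w hw (hphi1 w h1)
    have h3 := aux_Dderiv c α hα φ hφ w hw h1
    rw [Polynomial.IsRoot.def] at h2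
    rw [← hDdef, h2] at h3
    have hq := auxQ_ne α hα w hw.le
    have h4 : deriv φ w = 0 := by
      rcases mul_eq_zero.mp h3.symm with h | h
      · exact absurd (neg_eq_zero.mp h) hq
      · exact h
    rw [h4, mul_zero] at hs'
    exact hs.ne (by exact_mod_cast hs')
  have hcardf : Fintype.card D.roots.toFinset = n := by
    rw [Fintype.card_coe, Multiset.toFinset_card_of_nodup hnd, hcard]
  let e := Fintype.equivFinOfCardEq hcardf
  let lam : Fin n → ℂ := fun k => (e.symm k : ℂ)
  have hinj : Function.Injective lam := Subtype.val_injective.comp e.symm.injective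
  have hlam0 : ∀ k, D.eval (lam k) = 0 := by
    intro k
    have h := (e.symm k).2
    rw [Multiset.mem_toFinset] at h
    exact Polynomial.isRoot_of_mem_roots h
  have hlam1 : ∀ k, ‖lam k‖ = 1 := fun k => hroot _ (hlam0 k)
  have hDfac : D = Polynomial.C D.leadingCoeff * ∏ k, (Polynomial.X - Polynomial.C (lam k)) := by
    have h1 := Polynomial.C_leadingCoeff_mul_prod_multiset_X_sub_C (hcard.trans hDn.symm)
    have h2 : (D.roots.map fun a => Polynomial.X - Polynomial.C a).prod
        = ∏ k, (Polynomial.X - Polynomial.C (lam k)) := by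
      have h3 : (D.roots.map fun a => Polynomial.X - Polynomial.C a).prod
        = ∏ a ∈ D.roots.toFinset, (Polynomial.X - Polynomial.C a) := by
        rw [Finset.prod, Multiset.toFinset_val, hnd.dedup]
      rw [h3, ← Finset.prod_coe_sort]
      exact (Equiv.prod_comp e.symm
        (fun a : D.roots.toFinset => Polynomial.X - Polynomial.C (a : ℂ))).symm
    rw [← h2, h1]
  choose s hs hs' using fun k =>
    aux_deriv hn c hc α hα φ hφ (lam k) (hlam1 k) (hphi1 _ (hlam0 k))
  have hm : ∀ k, ((1 / s k : ℝ) : ℂ) = 1 / (lam k * deriv φ (lam k)) := by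
    intro k; rw [hs']; push_cast; rfl
  set N := auxQ α + auxP c α with hNdef
  have hNdeg : N.natDegree ≤ n :=
    (Polynomial.natDegree_add_le _ _).trans (max_le (auxQ_deg α) (auxP_deg c α))
  obtain ⟨κ, hκ⟩ := aux_pf N D hNdeg D.leadingCoeff (Polynomial.leadingCoeff_ne_zero.mpr hD0) lam
    hinj hDfac (fun k => ((1 / s k : ℝ) : ℂ)) (by
      intro k
      have hsk : (s k : ℂ) ≠ 0 := by exact_mod_cast (hs k).ne'
      have h0 := hlam0 k
      rw [hDdef, aux_Dderiv c α hα φ hφ (lam k) (hlam1 k) (hlam0 k)]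
      rw [hDdef, Polynomial.eval_sub, sub_eq_zero] at h0
      rw [hNdef, Polynomial.eval_add, ← h0]
      have : (((1 / s k : ℝ) : ℂ)) * (lam k * deriv φ (lam k)) = 1 := by
        rw [hs']; push_cast; field_simp
      linear_combination (-2 * (auxQ α).eval (lam k)) * this)
  have hDz : ∀ z : ℂ, ‖z‖ < 1 → D.eval z ≠ 0 := fun z hz h => hz.ne (hroot z h)
  have hfrac : ∀ z : ℂ, ‖z‖ < 1 → (1 + φ z) / (1 - φ z) = N.eval z / D.eval z := by
    intro z hz
    have hq := auxQ_ne α hα z hz.le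
    have hd := hDz z hz
    rw [hDdef, Polynomial.eval_sub] at hd
    have e1 : 1 - φ z = ((auxQ α).eval z - (auxP c α).eval z) / (auxQ α).eval z := by
      rw [aux_phi c α φ hφ, sub_div, div_self hq]
    have e2 : 1 + φ z = ((auxQ α).eval z + (auxP c α).eval z) / (auxQ α).eval z := by
      rw [aux_phi c α φ hφ, add_div, div_self hq]
    rw [e1, e2, hNdef, hDdef, Polynomial.eval_sub, Polynomial.eval_add,
      div_div_div_cancel_right₀ hq]
  have hlamne : ∀ k, lam k ≠ 0 := by
    intro k h; have := hlam1 k; rw [h] at this; simp at this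
  have hsum0 : ∑ k, ((1 / s k : ℝ) : ℂ) * (0 + lam k) / (0 - lam k)
      = -((∑ k, 1 / s k : ℝ) : ℂ) := by
    rw [Complex.ofReal_sum, ← sum_neg_distrib]
    apply sum_congr rfl
    intro k _
    have := hlamne k
    rw [zero_add, zero_sub, div_neg, mul_div_assoc, div_self this, mul_one]
  have hκ0 := hκ 0 (hDz 0 (by simp))
  rw [← hfrac 0 (by simp), hsum0] at hκ0
  have hphi0 : φ 0 = (((φ 0).re : ℝ) : ℂ) := Complex.ext (by simp) (by simpa using hreal)
  have hκim : κ.im = 0 := by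
    rw [← hκ0, hphi0]
    norm_cast
  -- a zero of N
  have hNw : ∃ w, N.eval w = 0 ∧ ‖w‖ = 1 := by
    have hN' : N = auxQ α - auxP (-c) α := by
      rw [hNdef]; simp [auxP]
    have hc' : ‖-c‖ = 1 := by rwa [norm_neg]
    have hdeg := auxD_deg hn (-c) hc' α hα
    rw [← hN'] at hdeg
    obtain ⟨w, hw⟩ := IsAlgClosed.exists_root N (by
      intro h
      have h0 : N.natDegree = 0 := Polynomial.natDegree_eq_of_degree_eq_some h
      exact hn.ne' (hdeg.symm.trans h0))
    refine ⟨w, hw, auxD_root hn (-c) hc' α hα w ?_⟩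
    rw [← hN']; exact hw
  obtain ⟨w, hNw, hw1⟩ := hNw
  have hDw : D.eval w ≠ 0 := by
    intro h
    apply auxQ_ne α hα w hw1.le
    rw [hDdef, Polynomial.eval_sub] at h
    rw [hNdef, Polynomial.eval_add] at hNw
    linear_combination (h + hNw) / 2
  have hκre : κ.re = 0 := by
    rw [← hκ w hDw, hNw, zero_div, zero_add, Complex.re_sum]
    apply sum_eq_zero
    intro k _
    rw [mul_div_assoc, Complex.re_ofReal_mul, aux_imag _ _ hw1 (hlam1 k), mul_zero]
  have hκz : κ = 0 := Complex.ext hκre hκim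
  refine ⟨lam, fun k => 1 / s k, hinj, hlam1, fun k => one_div_pos.mpr (hs k), ?_, hm, ?_⟩
  · intro z hz
    have := hκ z (hDz z hz)
    rw [hκz] at this
    rw [hfrac z hz]
    exact eq_neg_of_add_eq_zero_left this
  · rw [hκz] at hκ0
    have h1 : ((∑ k, 1 / s k : ℝ) : ℂ) = (1 + φ 0) / (1 - φ 0) := by
      linear_combination -hκ0
    have hne : 1 - φ 0 ≠ 0 := by
      intro h
      have hq := auxQ_ne α hα 0 (by simp)
      apply hDz 0 (by simp)
      rw [aux_phi c α φ hφ, sub_eq_zero, eq_div_iff hq, one_mul] at h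
      rw [hDdef, Polynomial.eval_sub, h, sub_self]
    have h2 : (∑ k, 1 / s k = 1) ↔ ((∑ k, 1 / s k : ℝ) : ℂ) = 1 := by
      norm_cast
    rw [h2, h1, div_eq_one_iff_eq hne]
    constructor
    · intro h; linear_combination h / 2
    · intro h; rw [h]; ring
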